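/- Grant the compatibility condition ζ ≤ √(2⌊K/2⌋)/(4K). There exist constants c=c(K)>0 and ε₀>0 such that whenever ε≤ε₀, δ≤1/6, L≤1/3 and n·δ²·ε⁴·ζ⁶ ≥ 1: the infimum over all estimators φ̂₃ (measurable functions of (Y₁,…,Yₙ)) of sup over (φ,ψ)∈Φ_L(δ,ε,ζ) of P_{(φ,ψ)}( |φ̂₃−φ₃|² ≥ c/(n·δ²·ε⁴·ζ⁴) ) is at least 1/4; and likewise the infimum over estimators of sup over Φ_L of P_{(φ,ψ)}( |φ̂₃/φ₃ − 1|² ≥ c/(n·δ²·ε⁴·ζ⁶) ) is at least 1/4. -/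

import Mathlib

open scoped BigOperators

namespace PaperHMM

/-- Parameter of a two-state HMM with multinomial emissions on `Fin K`. -/
structure Param (K : ℕ) where
  p : ℝ
  q : ℝ
  f0 : Fin K → ℝ
  f1 : Fin K → ℝ

/-- `f` is a probability density with respect to counting measure on `Fin K`. -/
def IsDensity {K : ℕ} (f : Fin K → ℝ) : Prop :=
  (∀ k, 0 ≤ f k) ∧ ∑ k, f k = 1

/-- Validity of HMM parameters: `p, q ∈ (0,1)` and emission densities. -/
def Valid {K : ℕ} (θ : Param K) : Prop :=
  θ.p ∈ Set.Ioo (0 : ℝ) 1 ∧ θ.q ∈ Set.Ioo (0 : ℝ) 1 ∧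
    IsDensity θ.f0 ∧ IsDensity θ.f1

/-- Euclidean norm of a finitely supported real function. -/
noncomputable def enormF {α : Type*} [Fintype α] (g : α → ℝ) : ℝ :=
  Real.sqrt (∑ a, (g a) ^ 2)

/-- Stationary initial distribution of the hidden chain: `P(X₁=0)=q/(p+q)`. -/
noncomputable def initD {K : ℕ} (θ : Param K) : Fin 2 → ℝ :=
  fun a => if a = 0 then θ.q / (θ.p + θ.q) else θ.p / (θ.p + θ.q)

/-- Transition matrix `Q = [[1-p, p], [q, 1-q]]` of the hidden chain. -/
noncomputable def transP {K : ℕ} (θ : Param K) : Fin 2 → Fin 2 → ℝ :=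
  fun a b =>
    if a = 0 then (if b = 0 then 1 - θ.p else θ.p)
    else (if b = 0 then θ.q else 1 - θ.q)

/-- Emission densities indexed by the hidden state. -/
def emit {K : ℕ} (θ : Param K) : Fin 2 → Fin K → ℝ :=
  fun a => if a = 0 then θ.f0 else θ.f1

/-- The probability mass function `p_θ^{(n)}` of the first `n` observations
`(Y₁,…,Yₙ)`:  `∑_{x ∈ {0,1}ⁿ} P(X₁=x₁) ∏_{i<n} Q_{x_i,x_{i+1}} ∏_{i≤n} f_{x_i}(y_i)`. -/
noncomputable def pLaw {K : ℕ} (θ : Param K) (n : ℕ) (y : Fin n → Fin K) : ℝ :=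
  ∑ x : Fin n → Fin 2,
    (∏ i : Fin n,
        (if (i : ℕ) = 0 then initD θ (x i)
          else transP θ (x ⟨(i : ℕ) - 1, lt_of_le_of_lt (Nat.sub_le _ _) i.isLt⟩) (x i)))
      * ∏ i : Fin n, emit θ (x i) (y i)

open Classical in
/-- Probability under `P_θ` that `(Y₁,…,Yₙ)` lies in the event `E`. -/
noncomputable def probOf {K : ℕ} (θ : Param K) (n : ℕ)
    (E : (Fin n → Fin K) → Prop) : ℝ :=
  ∑ y : Fin n → Fin K, if E y then pLaw θ n y else 0

/-- The parameter class `Θ(δ,ε,ζ)`. -/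
def ThetaSet (K : ℕ) (δ ε ζ : ℝ) : Set (Param K) :=
  {θ | Valid θ ∧ δ ≤ θ.p ∧ δ ≤ θ.q ∧ ε ≤ |1 - θ.p - θ.q| ∧
    ζ ≤ enormF (fun k => θ.f0 k - θ.f1 k)}

/-- The parameter class `Θ_L(δ,ε,ζ)`. -/
def ThetaL (K : ℕ) (L δ ε ζ : ℝ) : Set (Param K) :=
  ThetaSet K δ ε ζ ∩ {θ | L ≤ 1 - |1 - θ.p - θ.q|}

/-- The reparametrised pair `(φ, ψ)`: scalar parameters `φ = (φ₁,φ₂,φ₃)` and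
vector parameters `ψ = (ψ₁, ψ₂)`. -/
abbrev PP (K : ℕ) := (ℝ × ℝ × ℝ) × ((Fin K → ℝ) × (Fin K → ℝ))

/-- `φ(θ) = ((q-p)/(p+q), 1-p-q, ‖f₀-f₁‖)`. -/
noncomputable def phiOf {K : ℕ} (θ : Param K) : ℝ × ℝ × ℝ :=
  ((θ.q - θ.p) / (θ.p + θ.q), 1 - θ.p - θ.q,
    enormF (fun k => θ.f0 k - θ.f1 k))

/-- `ψ(θ) = ((q f₀ + p f₁)/(p+q), (f₀-f₁)/‖f₀-f₁‖)`. -/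
noncomputable def psiOf {K : ℕ} (θ : Param K) : (Fin K → ℝ) × (Fin K → ℝ) :=
  (fun k => (θ.q * θ.f0 k + θ.p * θ.f1 k) / (θ.p + θ.q),
    fun k => (θ.f0 k - θ.f1 k) / enormF (fun j => θ.f0 j - θ.f1 j))

/-- The map `θ ↦ (φ(θ), ψ(θ))`. -/
noncomputable def pack {K : ℕ} (θ : Param K) : PP K := (phiOf θ, psiOf θ)

/-- The inverse parametrisation `θ(φ,ψ)`:
`p = ½(1-φ₂)(1-φ₁)`, `q = ½(1-φ₂)(1+φ₁)`,
`f₀ = ψ₁ - ½φ₁φ₃ψ₂ + ½φ₃ψ₂`, `f₁ = ψ₁ - ½φ₁φ₃ψ₂ - ½φ₃ψ₂`. -/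
noncomputable def unpack {K : ℕ} (π : PP K) : Param K where
  p := (1 - π.1.2.1) * (1 - π.1.1) / 2
  q := (1 - π.1.2.1) * (1 + π.1.1) / 2
  f0 := fun k => π.2.1 k - π.1.1 * π.1.2.2 * π.2.2 k / 2 + π.1.2.2 * π.2.2 k / 2
  f1 := fun k => π.2.1 k - π.1.1 * π.1.2.2 * π.2.2 k / 2 - π.1.2.2 * π.2.2 k / 2

/-- `Φ(δ,ε,ζ)`. -/
def PhiSet (K : ℕ) (δ ε ζ : ℝ) : Set (PP K) := pack '' ThetaSet K δ ε ζ

/-- `Φ_L(δ,ε,ζ)`. -/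
def PhiL (K : ℕ) (L δ ε ζ : ℝ) : Set (PP K) := pack '' ThetaL K L δ ε ζ

/-- `⋃_{δ,ε,ζ} Φ(δ,ε,ζ)`. -/
def PhiAll (K : ℕ) : Set (PP K) :=
  ⋃ (δ ∈ Set.Ioo (0 : ℝ) 1) (ε ∈ Set.Ioo (0 : ℝ) 1) (ζ ∈ Set.Ioi (0 : ℝ)),
    PhiSet K δ ε ζ

/-- `r(φ) = ¼ (1-φ₁²) φ₂ φ₃²`. -/
noncomputable def rfun (φ : ℝ × ℝ × ℝ) : ℝ :=
  (1 - φ.1 ^ 2) * φ.2.1 * φ.2.2 ^ 2 / 4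

/-- `m(φ) = (r(φ), φ₂ r(φ), φ₁ φ₂ φ₃ r(φ))`. -/
noncomputable def mvec (φ : ℝ × ℝ × ℝ) : ℝ × ℝ × ℝ :=
  (rfun φ, φ.2.1 * rfun φ, φ.1 * φ.2.1 * φ.2.2 * rfun φ)

/-- Sign function with the convention `sgn 0 = +1`. -/
noncomputable def sgn (t : ℝ) : ℝ := if t < 0 then -1 else 1

/-- The statistical distance `ρ((φ,ψ);(φ̃,ψ̃))`. -/
noncomputable def rho {K : ℕ} (π π' : PP K) : ℝ :=
  max (max (max (max
    |(mvec π.1).1 - (mvec π'.1).1|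
    |(mvec π.1).2.1 - (mvec π'.1).2.1|)
    |(mvec π.1).2.2 - sgn (∑ k, π.2.2 k * π'.2.2 k) * (mvec π'.1).2.2|)
    (enormF fun k => π.2.1 k - π'.2.1 k))
    ((max |(mvec π.1).1| |(mvec π'.1).1|) *
      enormF fun k => π.2.2 k - sgn (∑ j, π.2.2 j * π'.2.2 j) * π'.2.2 k)

/-- `p^{(3)}_{φ,ψ} = p^{(3)}_{θ(φ,ψ)}`, the law of three consecutive observations. -/
noncomputable def p3 {K : ℕ} (π : PP K) : (Fin 3 → Fin K) → ℝ :=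
  pLaw (unpack π) 3

/-- The empirical estimator `p̂ₙ^{(3)}(a,b,c) = n⁻¹ ∑_{i=1}^{n-2} 1{Yᵢ=a, Y_{i+1}=b, Y_{i+2}=c}`. -/
noncomputable def empP3 {K : ℕ} (n : ℕ) (y : Fin n → Fin K)
    (v : Fin 3 → Fin K) : ℝ :=
  (n : ℝ)⁻¹ * ∑ i : Fin n,
    if h : (i : ℕ) + 2 < n then
      (if y i = v 0 ∧ y ⟨(i : ℕ) + 1, by omega⟩ = v 1 ∧ y ⟨(i : ℕ) + 2, h⟩ = v 2
        then 1 else 0)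
    else 0

/-- Kullback–Leibler divergence `K(P;Q) = ∑_y P(y) log(P(y)/Q(y))` between
probability mass functions on `(Fin K)ⁿ`. -/
noncomputable def klDiv {K : ℕ} (n : ℕ) (P Q : (Fin n → Fin K) → ℝ) : ℝ :=
  ∑ y : Fin n → Fin K, P y * Real.log (P y / Q y)

/-! ### Auxiliary material -/

/-- Forward functional: sum over hidden paths weighted by a function of the last hidden state. -/
noncomputable def fwd {K : ℕ} (θ : Param K) (n : ℕ) (y : Fin (n + 1) → Fin K)
    (g : Fin 2 → ℝ) : ℝ :=
  ∑ x : Fin (n + 1) → Fin 2,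
    ((∏ i : Fin (n + 1),
        (if (i : ℕ) = 0 then initD θ (x i)
          else transP θ (x ⟨(i : ℕ) - 1, lt_of_le_of_lt (Nat.sub_le _ _) i.isLt⟩) (x i)))
      * ∏ i : Fin (n + 1), emit θ (x i) (y i)) * g (x (Fin.last n))

lemma pLaw_eq_fwd {K : ℕ} (θ : Param K) (n : ℕ) (y : Fin (n + 1) → Fin K) :
    pLaw θ (n + 1) y = fwd θ n y (fun _ => 1) := by
  simp [pLaw, fwd]

lemma fwd_lin {K : ℕ} (θ : Param K) (n : ℕ) (y : Fin (n + 1) → Fin K)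
    (a b : ℝ) (g : Fin 2 → ℝ) :
    fwd θ n y (fun x => a + b * g x) = a * fwd θ n y (fun _ => 1) + b * fwd θ n y g := by
  unfold fwd
  rw [Finset.mul_sum, Finset.mul_sum, ← Finset.sum_add_distrib]
  refine Finset.sum_congr rfl fun x _ => ?_
  ring

lemma sum_snoc {α : Type*} [Fintype α] (n : ℕ) (F : (Fin (n + 1) → α) → ℝ) :
    ∑ y, F y = ∑ y : Fin n → α, ∑ k : α, F (Fin.snoc (α := fun _ => α) y k) := by
  classical
  rw [← (Fin.snocEquiv (fun _ => α)).sum_comp, Fintype.sum_prod_type, Finset.sum_comm]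
  rfl

lemma fwd_zero {K : ℕ} (θ : Param K) (y : Fin 1 → Fin K) (g : Fin 2 → ℝ) :
    fwd θ 0 y g = ∑ a, initD θ a * emit θ a (y 0) * g a := by
  unfold fwd
  rw [← (Equiv.funUnique (Fin 1) (Fin 2)).symm.sum_comp]
  refine Finset.sum_congr rfl fun x _ => ?_
  simp

lemma fwd_succ {K : ℕ} (θ : Param K) (n : ℕ) (y : Fin (n + 1) → Fin K) (k : Fin K)
    (g : Fin 2 → ℝ) :
    fwd θ (n + 1) (Fin.snoc (α := fun _ => Fin K) y k) g
      = fwd θ n y (fun a => ∑ b, transP θ a b * emit θ b k * g b) := by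
  unfold fwd
  rw [sum_snoc]
  refine Finset.sum_congr rfl fun x _ => ?_
  rw [Finset.mul_sum]
  refine Finset.sum_congr rfl fun b _ => ?_
  rw [Fin.prod_univ_castSucc, Fin.prod_univ_castSucc (n := n + 1)]
  have h1 : ∀ (i : Fin (n + 1)) (h : (i : ℕ) - 1 < n + 1 + 1),
      (Fin.snoc (α := fun _ => Fin 2) x b : Fin (n + 2) → Fin 2) ⟨(i : ℕ) - 1, h⟩
      = x ⟨(i : ℕ) - 1, lt_of_le_of_lt (Nat.sub_le _ _) i.isLt⟩ := by
    intro i h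
    exact Fin.snoc_castSucc (α := fun _ => Fin 2) b x
      ⟨(i : ℕ) - 1, lt_of_le_of_lt (Nat.sub_le _ _) i.isLt⟩
  have h2 : (Fin.snoc (α := fun _ => Fin 2) x b) ⟨((Fin.last (n + 1) : Fin (n + 2)) : ℕ) - 1,
        lt_of_le_of_lt (Nat.sub_le _ _) (Fin.last (n + 1)).isLt⟩ = x (Fin.last n) :=
    Fin.snoc_castSucc (α := fun _ => Fin 2) b x (Fin.last n)
  simp only [h1, h2, Fin.snoc_castSucc, Fin.snoc_last, Fin.val_castSucc]
  rw [if_neg (by simp)]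
  ring

/-- Sign pattern. -/
noncomputable def sg (K : ℕ) (k : Fin K) : ℝ :=
  if (k : ℕ) < 2 * (K / 2) then (-1) ^ (k : ℕ) else 0

lemma sum_range_aux (K : ℕ) (g : ℕ → ℝ) :
    ∑ k : Fin K, (if (k : ℕ) < 2 * (K / 2) then g k else 0)
      = ∑ i ∈ Finset.range (2 * (K / 2)), g i := by
  rw [Fin.sum_univ_eq_sum_range (fun i => if i < 2 * (K / 2) then g i else 0) K,
    ← Finset.sum_filter]
  congr 1
  ext i
  simp only [Finset.mem_filter, Finset.mem_range]
  omega

lemma sum_sg (K : ℕ) : ∑ k, sg K k = 0 := by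
  unfold sg
  rw [sum_range_aux K (fun i => (-1 : ℝ) ^ i)]
  induction (K / 2) with
  | zero => simp
  | succ m ih =>
    rw [show 2 * (m + 1) = 2 * m + 1 + 1 by ring, Finset.sum_range_succ, Finset.sum_range_succ, ih]
    simp [pow_succ]

lemma sg_sq (K : ℕ) (k : Fin K) : sg K k ^ 2 = if (k : ℕ) < 2 * (K / 2) then 1 else 0 := by
  unfold sg
  split_ifs
  · rw [← pow_mul, mul_comm, pow_mul]; simp
  · simp

lemma sum_sg_sq (K : ℕ) : ∑ k, sg K k ^ 2 = 2 * ((K / 2 : ℕ) : ℝ) := by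
  simp only [sg_sq]
  rw [sum_range_aux K (fun _ => (1 : ℝ))]
  simp

lemma sg_sq_le (K : ℕ) (k : Fin K) : sg K k ^ 2 ≤ 1 := by
  rw [sg_sq]; split_ifs <;> norm_num

lemma abs_sg_le (K : ℕ) (k : Fin K) : |sg K k| ≤ 1 := by
  rw [← sq_le_one_iff_abs_le_one]; exact sg_sq_le K k

/-- The hidden-state effect `u`. -/
noncomputable def uf (w φ : ℝ) : Fin 2 → ℝ :=
  fun a => if a = 0 then (1 - φ) / 2 * w else -((1 + φ) / 2 * w)

/-- The family of models used in the lower bound. -/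
noncomputable def model (K : ℕ) (ε w φ : ℝ) : Param K where
  p := (1 - ε) * (1 - φ) / 2
  q := (1 - ε) * (1 + φ) / 2
  f0 := fun k => (1 + uf w φ 0 * sg K k) / K
  f1 := fun k => (1 + uf w φ 1 * sg K k) / K

/-- Observation law of the model. -/
noncomputable def mP {K : ℕ} (ε w φ : ℝ) (n : ℕ) (y : Fin (n + 1) → Fin K) : ℝ :=
  fwd (model K ε w φ) n y (fun _ => 1)

/-- Unnormalised predictor. -/
noncomputable def mM {K : ℕ} (ε w φ : ℝ) (n : ℕ) (y : Fin (n + 1) → Fin K) : ℝ :=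
  ε * fwd (model K ε w φ) n y (uf w φ)

lemma mP_zero {K : ℕ} (ε w φ : ℝ) (hε : ε < 1) (y : Fin 1 → Fin K) :
    mP ε w φ 0 y = 1 / K := by
  have : (1 - ε) ≠ 0 := by linarith
  unfold mP
  rw [fwd_zero]
  have h : (1 - ε) * (1 - φ) / 2 + (1 - ε) * (1 + φ) / 2 = 1 - ε := by ring
  simp only [Fin.sum_univ_two, initD, emit, model, uf, h]
  simp
  field_simp
  ring

lemma mM_zero {K : ℕ} (ε w φ : ℝ) (hε : ε < 1) (y : Fin 1 → Fin K) :
    mM ε w φ 0 y = ε * (sg K (y 0) * ((1 - φ ^ 2) * w ^ 2 / 4)) / K := by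
  have : (1 - ε) ≠ 0 := by linarith
  unfold mM
  rw [fwd_zero]
  have h : (1 - ε) * (1 - φ) / 2 + (1 - ε) * (1 + φ) / 2 = 1 - ε := by ring
  simp only [Fin.sum_univ_two, initD, emit, model, uf, h]
  simp
  field_simp
  ring

lemma mP_succ {K : ℕ} (ε w φ : ℝ) (n : ℕ) (y : Fin (n + 1) → Fin K) (k : Fin K) :
    mP ε w φ (n + 1) (Fin.snoc (α := fun _ => Fin K) y k)
      = (mP ε w φ n y + sg K k * mM ε w φ n y) / K := by
  unfold mP mM
  rw [fwd_succ]
  have : (fun a => ∑ b, transP (model K ε w φ) a b * emit (model K ε w φ) b k * 1)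
      = fun a => (1 / K : ℝ) + (sg K k * ε / K) * uf w φ a := by
    funext a
    fin_cases a <;> simp [Fin.sum_univ_two, transP, emit, model, uf] <;> ring
  rw [this, fwd_lin]
  ring

lemma mM_succ {K : ℕ} (ε w φ : ℝ) (n : ℕ) (y : Fin (n + 1) → Fin K) (k : Fin K) :
    mM ε w φ (n + 1) (Fin.snoc (α := fun _ => Fin K) y k)
      = ε * (mM ε w φ n y + sg K k * (-(φ * w) * mM ε w φ n y
          + (1 - φ ^ 2) * w ^ 2 / 4 * mP ε w φ n y)) / K := by
  unfold mP mM
  rw [fwd_succ]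
  have : (fun a => ∑ b, transP (model K ε w φ) a b * emit (model K ε w φ) b k * uf w φ b)
      = fun a => (sg K k * ((1 - φ ^ 2) * w ^ 2 / 4) / K : ℝ)
        + ((1 + sg K k * (-(φ * w))) * ε / K) * uf w φ a := by
    funext a
    fin_cases a <;> simp [Fin.sum_univ_two, transP, emit, model, uf] <;> ring
  rw [this, fwd_lin]
  ring

/-- One filter step. -/
noncomputable def step (ε σ v s a : ℝ) : ℝ := ε * (a + s * (σ * a + v)) / (1 + s * a)

lemma step_bound {ε σ v s a : ℝ} (h0 : 0 < ε) (hε : ε ≤ 1 / 16) (hσ : |σ| ≤ 1) (hv0 : 0 ≤ v)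
    (hv : v ≤ 1 / 4) (hs : |s| ≤ 1) (ha : |a| ≤ 2 * ε * v) : |step ε σ v s a| ≤ 2 * ε * v := by
  have hev : ε * v ≤ 1 / 64 := by nlinarith
  have hsa : |s * a| ≤ 1 / 32 := by
    rw [abs_mul]
    nlinarith [abs_nonneg s, abs_nonneg a]
  have hd : 31 / 32 ≤ 1 + s * a := by linarith [(abs_le.1 hsa).1]
  have hσa : |σ * a| ≤ 2 * ε * v := by
    rw [abs_mul]; nlinarith [abs_nonneg σ, abs_nonneg a]
  have hn : |a + s * (σ * a + v)| ≤ 2 * ε * v + (2 * ε * v + v) := by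
    refine (abs_add_le _ _).trans (add_le_add ha ?_)
    rw [abs_mul]
    have : |σ * a + v| ≤ 2 * ε * v + v :=
      (abs_add_le _ _).trans (add_le_add hσa (abs_of_nonneg hv0).le)
    nlinarith [abs_nonneg s, abs_nonneg (σ * a + v)]
  unfold step
  rw [abs_div, abs_mul, abs_of_pos h0, abs_of_pos (show 0 < 1 + s * a by linarith),
    div_le_iff₀ (by linarith)]
  have hb : |a + s * (σ * a + v)| ≤ 5 / 4 * v := by nlinarith
  have h1 : ε * |a + s * (σ * a + v)| ≤ ε * (5 / 4 * v) := by gcongr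
  have h2 : 2 * ε * v * (31 / 32) ≤ 2 * ε * v * (1 + s * a) := by gcongr
  nlinarith [mul_nonneg h0.le hv0]

lemma step_diff {ε σ σ' v s a b : ℝ} (h0 : 0 < ε) (hε : ε ≤ 1 / 16) (hσ : |σ| ≤ 1) (hv0 : 0 ≤ v)
    (hv : v ≤ 1 / 4) (hs : |s| ≤ 1) (ha : |a| ≤ 2 * ε * v)
    (hb : |b| ≤ 2 * ε * v) (hab : |a - b| ≤ 4 * ε ^ 2 * v * |σ - σ'|) :
    |step ε σ v s a - step ε σ' v s b| ≤ 4 * ε ^ 2 * v * |σ - σ'| := by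
  have hev : ε * v ≤ 1 / 64 := by nlinarith
  have hsa : |s * a| ≤ 1 / 32 := by
    rw [abs_mul]
    nlinarith [abs_nonneg s, abs_nonneg a]
  have hd : 31 / 32 ≤ 1 + s * a := by linarith [(abs_le.1 hsa).1]
  have hsb : |s * b| ≤ 1 / 32 := by
    rw [abs_mul]
    nlinarith [abs_nonneg s, abs_nonneg b]
  have hd' : 31 / 32 ≤ 1 + s * b := by linarith [(abs_le.1 hsb).1]
  have key : step ε σ v s a - step ε σ' v s b
      = ε * ((1 + s * σ - s ^ 2 * v) * (a - b) / ((1 + s * a) * (1 + s * b))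
        + s * (σ - σ') * b / (1 + s * b)) := by
    unfold step
    have h1 : 1 + s * a ≠ 0 := by linarith
    have h2 : 1 + s * b ≠ 0 := by linarith
    obtain ⟨A, hA⟩ : ∃ A, A = 1 + s * a := ⟨_, rfl⟩
    obtain ⟨B, hB⟩ : ∃ B, B = 1 + s * b := ⟨_, rfl⟩
    rw [← hA] at h1 ⊢
    rw [← hB] at h2 ⊢
    field_simp
    rw [hA, hB]
    ring
  have hc : |1 + s * σ - s ^ 2 * v| ≤ 9 / 4 := by
    have h1 : |s * σ| ≤ 1 := by
      rw [abs_mul]; nlinarith [abs_nonneg s, abs_nonneg σ]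
    have h2 : s ^ 2 ≤ 1 := (sq_le_one_iff_abs_le_one s).2 hs
    have h3 := abs_le.1 h1
    rw [abs_le]
    constructor <;> nlinarith [sq_nonneg s]
  set η := 4 * ε ^ 2 * v * |σ - σ'| with hη
  have hη0 : 0 ≤ η := (abs_nonneg _).trans hab
  have e1 : |(1 + s * σ - s ^ 2 * v) * (a - b) / ((1 + s * a) * (1 + s * b))| ≤ 4 * η := by
    rw [abs_div, abs_mul, abs_of_pos (show 0 < (1 + s * a) * (1 + s * b) by nlinarith),
      div_le_iff₀ (by nlinarith)]
    have : (9 / 10 : ℝ) ≤ (1 + s * a) * (1 + s * b) := by nlinarith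
    calc _ ≤ 9 / 4 * η := by gcongr
      _ ≤ 4 * η * (9 / 10) := by linarith
      _ ≤ _ := by gcongr
  have e2 : ε * |s * (σ - σ') * b / (1 + s * b)| ≤ 6 / 10 * η := by
    rw [abs_div, abs_mul, abs_mul, abs_of_pos (show 0 < 1 + s * b by linarith), ← mul_div_assoc,
      div_le_iff₀ (by linarith)]
    calc ε * (|s| * |σ - σ'| * |b|) ≤ ε * (1 * |σ - σ'| * (2 * ε * v)) := by gcongr
      _ = η / 2 := by rw [hη]; ring
      _ ≤ 6 / 10 * η * (31 / 32) := by linarith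
      _ ≤ _ := by gcongr
  rw [key, abs_mul, abs_of_pos h0]
  calc _ ≤ ε * (|(1 + s * σ - s ^ 2 * v) * (a - b) / ((1 + s * a) * (1 + s * b))|
        + |s * (σ - σ') * b / (1 + s * b)|) := by gcongr; exact abs_add_le _ _
    _ ≤ ε * (4 * η) + 6 / 10 * η := by rw [mul_add]; gcongr
    _ ≤ 1 / 16 * (4 * η) + 6 / 10 * η := by gcongr
    _ ≤ η := by linarith

lemma exists_snoc {α : Type*} (n : ℕ) (y : Fin (n + 1) → α) :
    ∃ (z : Fin n → α) (k : α), y = Fin.snoc (α := fun _ => α) z k :=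
  ⟨Fin.init (α := fun _ => α) y, y (Fin.last n), (Fin.snoc_init_self (α := fun _ => α) y).symm⟩

lemma mono_inv {K : ℕ} (hK : 2 ≤ K) {ε w φ v : ℝ} (h0 : 0 < ε) (hε : ε ≤ 1 / 16)
    (hv : (1 - φ ^ 2) * w ^ 2 / 4 = v) (hσ : |-(φ * w)| ≤ 1) (hv0 : 0 ≤ v) (hv4 : v ≤ 1 / 4)
    (n : ℕ) (y : Fin (n + 1) → Fin K) :
    0 < mP ε w φ n y ∧ |mM ε w φ n y / mP ε w φ n y| ≤ 2 * ε * v := by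
  have hK0 : (0 : ℝ) < K := by positivity
  induction n with
  | zero =>
    rw [mP_zero _ _ _ (by linarith), mM_zero _ _ _ (by linarith), hv]
    refine ⟨by positivity, ?_⟩
    have : ε * (sg K (y 0) * v) / K / (1 / K) = step ε (-(φ * w)) v (sg K (y 0)) 0 := by
      unfold step
      field_simp
      ring
    rw [this]
    exact step_bound h0 hε hσ hv0 hv4 (abs_sg_le _ _) (by simp; positivity)
  | succ n ih =>
    obtain ⟨z, k, rfl⟩ := exists_snoc _ y
    obtain ⟨hP, hM⟩ := ih z
    set a := mM ε w φ n z / mP ε w φ n z with ha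
    have hMa : mM ε w φ n z = a * mP ε w φ n z := by rw [ha]; field_simp
    have hb := step_bound h0 hε hσ hv0 hv4 (abs_sg_le K k) hM
    have hsa : |sg K k * a| ≤ 1 / 32 := by
      rw [abs_mul]
      nlinarith [abs_nonneg (sg K k), abs_nonneg a, abs_sg_le K k]
    have hd : 31 / 32 ≤ 1 + sg K k * a := by linarith [(abs_le.1 hsa).1]
    have hd0 : 1 + sg K k * a ≠ 0 := by linarith
    rw [mP_succ, mM_succ, hv, hMa]
    have e : mP ε w φ n z + sg K k * (a * mP ε w φ n z)
      = mP ε w φ n z * (1 + sg K k * a) := by ring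
    rw [e]
    refine ⟨by have : 0 < 1 + sg K k * a := by linarith
               positivity, ?_⟩
    convert hb using 2
    unfold step
    field_simp

lemma snoc_ratio {K : ℕ} (hK : 2 ≤ K) {ε w φ v : ℝ}
    (hv : (1 - φ ^ 2) * w ^ 2 / 4 = v) 
    (n : ℕ) (z : Fin (n + 1) → Fin K) (k : Fin K) (hP : 0 < mP ε w φ n z)
    (hd0 : 1 + sg K k * (mM ε w φ n z / mP ε w φ n z) ≠ 0) :
    mM ε w φ (n + 1) (Fin.snoc (α := fun _ => Fin K) z k)
      / mP ε w φ (n + 1) (Fin.snoc (α := fun _ => Fin K) z k)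
      = step ε (-(φ * w)) v (sg K k) (mM ε w φ n z / mP ε w φ n z) := by
  have hK0 : (0 : ℝ) < K := by positivity
  set a := mM ε w φ n z / mP ε w φ n z with ha
  have hMa : mM ε w φ n z = a * mP ε w φ n z := by rw [ha]; field_simp
  rw [mP_succ, mM_succ, hv, hMa]
  have e : mP ε w φ n z + sg K k * (a * mP ε w φ n z)
      = mP ε w φ n z * (1 + sg K k * a) := by ring
  rw [e]
  unfold step
  field_simp

lemma diff_inv {K : ℕ} (hK : 2 ≤ K) {ε w φ w' φ' v : ℝ} (h0 : 0 < ε) (hε : ε ≤ 1 / 16)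
    (hv : (1 - φ ^ 2) * w ^ 2 / 4 = v) (hv' : (1 - φ' ^ 2) * w' ^ 2 / 4 = v)
    (hσ : |-(φ * w)| ≤ 1) (hσ' : |-(φ' * w')| ≤ 1) (hv0 : 0 ≤ v) (hv4 : v ≤ 1 / 4)
    (n : ℕ) (y : Fin (n + 1) → Fin K) :
    |mM ε w φ n y / mP ε w φ n y - mM ε w' φ' n y / mP ε w' φ' n y|
      ≤ 4 * ε ^ 2 * v * |-(φ * w) - -(φ' * w')| := by
  have hK0 : (0 : ℝ) < K := by positivity
  induction n with
  | zero =>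
    rw [mP_zero _ _ _ (by linarith), mM_zero _ _ _ (by linarith), hv,
      mP_zero _ _ _ (by linarith), mM_zero _ _ _ (by linarith), hv', sub_self, abs_zero]
    positivity
  | succ n ih =>
    obtain ⟨z, k, rfl⟩ := exists_snoc _ y
    obtain ⟨hP, hM⟩ := mono_inv hK h0 hε hv hσ hv0 hv4 n z
    obtain ⟨hP', hM'⟩ := mono_inv hK h0 hε hv' hσ' hv0 hv4 n z
    have aux : ∀ a : ℝ, |a| ≤ 2 * ε * v → 1 + sg K k * a ≠ 0 := by
      intro a ha
      have hev : ε * v ≤ 1 / 64 := by nlinarith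
      have hsa : |sg K k * a| ≤ 1 / 32 := by
        rw [abs_mul]
        nlinarith [abs_nonneg (sg K k), abs_nonneg a, abs_sg_le K k]
      linarith [(abs_le.1 hsa).1]
    rw [snoc_ratio hK hv n z k hP (aux _ hM), snoc_ratio hK hv' n z k hP' (aux _ hM')]
    exact step_diff h0 hε hσ hv0 hv4 (abs_sg_le K k) hM hM' (ih z)

lemma sum_mP {K : ℕ} (hK : 2 ≤ K) {ε w φ : ℝ} (hε : ε < 1) (n : ℕ) :
    ∑ y : Fin (n + 1) → Fin K, mP ε w φ n y = 1 := by
  have hK0 : (K : ℝ) ≠ 0 := by positivity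
  induction n with
  | zero => simp [mP_zero _ _ _ hε, hK0]
  | succ n ih =>
    rw [sum_snoc, ← ih]
    refine Finset.sum_congr rfl fun y _ => ?_
    simp only [mP_succ]
    rw [← Finset.sum_div, Finset.sum_add_distrib, ← Finset.sum_mul, sum_sg]
    simp
    field_simp

lemma chi_bound {K : ℕ} (hK : 2 ≤ K) {ε w φ w' φ' v : ℝ} (h0 : 0 < ε) (hε : ε ≤ 1 / 16)
    (hv : (1 - φ ^ 2) * w ^ 2 / 4 = v) (hv' : (1 - φ' ^ 2) * w' ^ 2 / 4 = v)
    (hσ : |-(φ * w)| ≤ 1) (hσ' : |-(φ' * w')| ≤ 1) (hv0 : 0 ≤ v) (hv4 : v ≤ 1 / 4)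
    (n : ℕ) :
    ∑ y : Fin (n + 1) → Fin K, mP ε w φ n y ^ 2 / mP ε w' φ' n y
      ≤ (1 + 2 * (4 * ε ^ 2 * v * |-(φ * w) - -(φ' * w')|) ^ 2) ^ n := by
  have hK0 : (0 : ℝ) < K := by positivity
  set η := 4 * ε ^ 2 * v * |-(φ * w) - -(φ' * w')| with hη
  induction n with
  | zero =>
    simp only [mP_zero _ _ _ (show ε < 1 by linarith)]
    simp
    apply le_of_eq
    field_simp
  | succ n ih =>
    rw [sum_snoc, pow_succ]
    refine le_trans ?_ (mul_le_mul_of_nonneg_right ih (by positivity))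
    rw [Finset.sum_mul]
    refine Finset.sum_le_sum fun z _ => ?_
    obtain ⟨hP, hM⟩ := mono_inv hK h0 hε hv hσ hv0 hv4 n z
    obtain ⟨hP', hM'⟩ := mono_inv hK h0 hε hv' hσ' hv0 hv4 n z
    have hD := diff_inv hK h0 hε hv hv' hσ hσ' hv0 hv4 n z
    rw [← hη] at hD
    simp only [mP_succ]
    set P := mP ε w φ n z
    set Q := mP ε w' φ' n z
    set a := mM ε w φ n z / P with ha
    have hMa : mM ε w φ n z = a * P := by rw [ha]; field_simp
    set b := mM ε w' φ' n z / Q with hb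
    have hMb : mM ε w' φ' n z = b * Q := by rw [hb]; field_simp
    rw [hMa, hMb]
    have hpt : ∀ k : Fin K, ((P + sg K k * (a * P)) / K) ^ 2 / ((Q + sg K k * (b * Q)) / K)
        ≤ P ^ 2 / Q * ((1 + 2 * η ^ 2) / K + (2 * a - b) / K * sg K k) := by
      intro k
      have hev : ε * v ≤ 1 / 64 := by nlinarith
      have hsb : |sg K k * b| ≤ 1 / 32 := by
        rw [abs_mul]
        nlinarith [abs_nonneg (sg K k), abs_nonneg b, abs_sg_le K k]
      have hd : 31 / 32 ≤ 1 + sg K k * b := by linarith [(abs_le.1 hsb).1]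
      have hd0 : 0 < 1 + sg K k * b := by linarith
      have e : ((P + sg K k * (a * P)) / K) ^ 2 / ((Q + sg K k * (b * Q)) / K)
          = P ^ 2 / Q * (((1 + sg K k * a) ^ 2 / (1 + sg K k * b)) / K) := by
        have e1 : Q + sg K k * (b * Q) = Q * (1 + sg K k * b) := by ring
        have e2 : P + sg K k * (a * P) = P * (1 + sg K k * a) := by ring
        rw [e1, e2]
        field_simp
      rw [e]
      have e3 : (1 + 2 * η ^ 2) / K + (2 * a - b) / K * sg K k
          = (1 + 2 * η ^ 2 + (2 * a - b) * sg K k) / K := by ring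
      rw [e3]
      gcongr
      rw [div_le_iff₀ hd0]
      have h1 : (a - b) ^ 2 ≤ η ^ 2 := by
        rw [← sq_abs]; gcongr
      have h2 := sg_sq_le K k
      have h3 : (sg K k) ^ 2 * (a - b) ^ 2 ≤ 1 * η ^ 2 := by gcongr
      nlinarith [sq_nonneg η]
    refine (Finset.sum_le_sum fun k _ => hpt k).trans (le_of_eq ?_)
    rw [← Finset.mul_sum, Finset.sum_add_distrib, ← Finset.mul_sum, sum_sg]
    rw [Finset.sum_const, Finset.card_univ, Fintype.card_fin, nsmul_eq_mul]
    field_simp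
    ring

lemma two_point {Y : Type*} [Fintype Y] (P Q : Y → ℝ) (hP : ∀ y, 0 < P y) (hQ : ∀ y, 0 < Q y)
    (hs : ∑ y, P y = 1) (hc : ∑ y, P y ^ 2 / Q y ≤ 2) (E E' : Y → Prop)
    [DecidablePred E] [DecidablePred E'] (hE : ∀ y, E y ∨ E' y) :
    1 / 2 ≤ (∑ y, if E y then P y else 0) + ∑ y, if E' y then Q y else 0 := by
  rw [← Finset.sum_add_distrib]
  have : ∑ y, (P y - P y ^ 2 / Q y / 4) ≤
      ∑ y, ((if E y then P y else 0) + if E' y then Q y else 0) := by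
    refine Finset.sum_le_sum fun y _ => ?_
    have h1 := hP y
    have h2 := hQ y
    have h3 : 0 ≤ P y ^ 2 / Q y := by positivity
    have h4 : P y - P y ^ 2 / Q y / 4 ≤ Q y := by
      have : Q y - (P y - P y ^ 2 / Q y / 4) = (2 * Q y - P y) ^ 2 / (4 * Q y) := by
        field_simp
        ring
      have h5 : 0 ≤ (2 * Q y - P y) ^ 2 / (4 * Q y) := by positivity
      linarith
    rcases hE y with h | h
    · rw [if_pos h]; split_ifs <;> linarith
    · rw [if_pos h]; split_ifs <;> linarith
  rw [Finset.sum_sub_distrib, ← Finset.sum_div, hs] at this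
  linarith

lemma unpack_pack {K : ℕ} (θ : Param K) (h : θ.p + θ.q ≠ 0)
    (hd : enormF (fun k => θ.f0 k - θ.f1 k) ≠ 0) : unpack (pack θ) = θ := by
  obtain ⟨p, q, f0, f1⟩ := θ
  simp only at h hd
  simp only [unpack, pack, phiOf, psiOf, Param.mk.injEq]
  refine ⟨?_, ?_, ?_, ?_⟩
  · field_simp; ring
  · field_simp; ring
  · funext k
    field_simp; ring
  · funext k
    field_simp; ring

lemma density_le_one {K : ℕ} {f : Fin K → ℝ} (h : IsDensity f) (k : Fin K) : f k ≤ 1 := by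
  rw [← h.2]
  exact Finset.single_le_sum (fun i _ => h.1 i) (Finset.mem_univ k)

lemma pLaw_bounds {K : ℕ} (θ : Param K) (h : Valid θ) (n : ℕ) (y : Fin n → Fin K) :
    0 ≤ pLaw θ n y ∧ pLaw θ n y ≤ 2 ^ n := by
  obtain ⟨⟨hp0, hp1⟩, ⟨hq0, hq1⟩, hf0, hf1⟩ := h
  have hi : ∀ a, 0 ≤ initD θ a ∧ initD θ a ≤ 1 := by
    intro a
    unfold initD
    split_ifs
    · exact ⟨by positivity, by rw [div_le_one (by positivity)]; linarith⟩
    · exact ⟨by positivity, by rw [div_le_one (by positivity)]; linarith⟩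
  have ht : ∀ a b, 0 ≤ transP θ a b ∧ transP θ a b ≤ 1 := by
    intro a b
    unfold transP
    split_ifs <;> constructor <;> linarith
  have he : ∀ a k, 0 ≤ emit θ a k ∧ emit θ a k ≤ 1 := by
    intro a k
    unfold emit
    split_ifs
    · exact ⟨hf0.1 k, density_le_one hf0 k⟩
    · exact ⟨hf1.1 k, density_le_one hf1 k⟩
  have hw : ∀ (x : Fin n → Fin 2) (i : Fin n), 0 ≤ (if (i : ℕ) = 0 then initD θ (x i)
          else transP θ (x ⟨(i : ℕ) - 1, lt_of_le_of_lt (Nat.sub_le _ _) i.isLt⟩) (x i)) ∧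
        (if (i : ℕ) = 0 then initD θ (x i)
          else transP θ (x ⟨(i : ℕ) - 1, lt_of_le_of_lt (Nat.sub_le _ _) i.isLt⟩) (x i)) ≤ 1 := by
    intro x i
    split_ifs
    · exact hi _
    · exact ht _ _
  unfold pLaw
  constructor
  · refine Finset.sum_nonneg fun x _ => mul_nonneg ?_ ?_
    · exact Finset.prod_nonneg fun i _ => (hw x i).1
    · exact Finset.prod_nonneg fun i _ => (he _ _).1
  · have : (2 : ℝ) ^ n = ∑ x : Fin n → Fin 2, (1 : ℝ) := by simp
    rw [this]
    refine Finset.sum_le_sum fun x _ => ?_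
    refine mul_le_one₀ ?_ ?_ ?_
    · exact Finset.prod_le_one (fun i _ => (hw x i).1) fun i _ => (hw x i).2
    · exact Finset.prod_nonneg fun i _ => (he _ _).1
    · exact Finset.prod_le_one (fun i _ => (he _ _).1) fun i _ => (he _ _).2

lemma probOf_le {K : ℕ} (θ : Param K) (h : Valid θ) (n : ℕ) (E : (Fin n → Fin K) → Prop) :
    probOf θ n E ≤ ∑ _y : Fin n → Fin K, (2 : ℝ) ^ n := by
  unfold probOf
  refine Finset.sum_le_sum fun y _ => ?_
  split_ifs
  · exact (pLaw_bounds θ h n y).2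
  · positivity

lemma sup_ge {K : ℕ} {L δ ε ζ : ℝ} (hζ : 0 < ζ) (n : ℕ) (E : PP K → (Fin n → Fin K) → Prop)
    (θ : Param K) (hθ : θ ∈ ThetaL K L δ ε ζ) :
    probOf θ n (E (pack θ)) ≤ ⨆ π ∈ PhiL K L δ ε ζ, probOf (unpack π) n (E π) := by
  have hup : ∀ θ ∈ ThetaL K L δ ε ζ, unpack (pack θ) = θ := by
    intro θ hθ
    obtain ⟨⟨hv, _, _, _, h⟩, _⟩ := hθ
    refine unpack_pack θ ?_ (by linarith)
    have := hv.1.1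
    have := hv.2.1.1
    linarith
  have hb : BddAbove (Set.range fun π : PP K =>
      ⨆ (_ : π ∈ PhiL K L δ ε ζ), probOf (unpack π) n (E π)) := by
    refine ⟨∑ _y : Fin n → Fin K, (2 : ℝ) ^ n, ?_⟩
    rintro _ ⟨π, rfl⟩
    by_cases h : π ∈ PhiL K L δ ε ζ
    · simp only [h, ciSup_unique]
      obtain ⟨θ', hθ', rfl⟩ := h
      rw [hup θ' hθ']
      exact probOf_le θ' hθ'.1.1 n _
    · simp only [h]
      rw [Real.iSup_of_isEmpty]
      positivity
  have hm : pack θ ∈ PhiL K L δ ε ζ := ⟨θ, hθ, rfl⟩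
  have := le_ciSup hb (pack θ)
  simp only [hm, ciSup_unique, hup θ hθ] at this
  exact this

lemma model_enorm {K : ℕ} (hK : 2 ≤ K) (ε w φ : ℝ) (hw : 0 ≤ w) :
    enormF (fun k => (model K ε w φ).f0 k - (model K ε w φ).f1 k)
      = w * Real.sqrt (2 * ((K / 2 : ℕ) : ℝ)) / K := by
  have hK0 : (0 : ℝ) < K := by positivity
  unfold enormF
  have : ∀ k, ((model K ε w φ).f0 k - (model K ε w φ).f1 k) ^ 2
      = (w / K) ^ 2 * sg K k ^ 2 := by
    intro k
    simp [model, uf]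
    ring
  simp only [this]
  rw [← Finset.mul_sum, sum_sg_sq, Real.sqrt_mul (by positivity), Real.sqrt_sq (by positivity)]
  ring

lemma model_mem {K : ℕ} (hK : 2 ≤ K) {L δ ε ζ w φ : ℝ} (hL : L ≤ 1 / 3) (hδ : 0 < δ)
    (h0 : 0 < ε) (hε : ε ≤ 1 / 16) (hw : 0 ≤ w) (hw1 : w ≤ 1) (hφ : 0 ≤ φ) (hφ1 : φ ≤ 1)
    (hp : δ ≤ (1 - ε) * (1 - φ) / 2) (hq : δ ≤ (1 - ε) * (1 + φ) / 2)
    (hζ : ζ ≤ w * Real.sqrt (2 * ((K / 2 : ℕ) : ℝ)) / K) :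
    model K ε w φ ∈ ThetaL K L δ ε ζ := by
  have hK0 : (0 : ℝ) < K := by positivity
  have hpq : 1 - (model K ε w φ).p - (model K ε w φ).q = ε := by simp [model]; ring
  have hdens : ∀ u : ℝ, |u| ≤ 1 → IsDensity (fun k => (1 + u * sg K k) / (K : ℝ)) := by
    intro u hu
    constructor
    · intro k
      have : |u * sg K k| ≤ 1 := by
        rw [abs_mul]
        exact mul_le_one₀ hu (abs_nonneg _) (abs_sg_le K k)
      have := (abs_le.1 this).1
      exact div_nonneg (by linarith) hK0.le
    · rw [← Finset.sum_div, Finset.sum_add_distrib, ← Finset.mul_sum, sum_sg]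
      simp [hK0.ne']
  refine ⟨⟨⟨⟨?_, ?_⟩, ⟨?_, ?_⟩, ?_, ?_⟩, hp, hq, ?_, ?_⟩, ?_⟩
  · exact lt_of_lt_of_le hδ hp
  · simp only [model]; nlinarith
  · exact lt_of_lt_of_le hδ hq
  · simp only [model]; nlinarith
  · refine hdens _ ?_
    simp only [uf, if_true]
    rw [abs_le]; constructor <;> nlinarith
  · refine hdens _ ?_
    simp only [uf]
    rw [abs_le]; constructor <;> simp <;> nlinarith
  · rw [hpq, abs_of_pos h0]
  · rw [model_enorm hK _ _ _ hw]; exact hζ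
  · change L ≤ 1 - |1 - (model K ε w φ).p - (model K ε w φ).q|
    rw [hpq, abs_of_pos h0]; linarith

lemma exists_phi {δ w t : ℝ} (hδ : 0 < δ) (hδ6 : δ ≤ 1 / 6) (hw : 0 < w) (ht : 0 ≤ t)
    (ht1 : t ≤ 1 / 10) :
    ∃ φ' : ℝ, 0 ≤ φ' ∧ φ' ≤ 1 ∧ 22 / 10 * δ ≤ 1 - φ' ∧
      (1 - φ' ^ 2) * (w * (1 + t)) ^ 2 / 4 = (1 - (1 - 4 * δ) ^ 2) * w ^ 2 / 4 ∧
      |-(φ' * (w * (1 + t))) - -((1 - 4 * δ) * w)| ≤ 3 * w * t := by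
  set b := 1 - (1 - 4 * δ) ^ 2 with hb
  have hb0 : 0 < b := by nlinarith
  have hb1 : b ≤ 8 / 9 := by nlinarith
  have hT : 0 < (1 + t) ^ 2 := by positivity
  have hT1 : 1 ≤ (1 + t) ^ 2 := by nlinarith
  have hle : b / (1 + t) ^ 2 ≤ b := div_le_self hb0.le hT1
  set φ' := Real.sqrt (1 - b / (1 + t) ^ 2) with hφ
  have hsq : φ' ^ 2 = 1 - b / (1 + t) ^ 2 := Real.sq_sqrt (by linarith)
  have hφ0 : 0 ≤ φ' := Real.sqrt_nonneg _
  have hbt : 0 < b / (1 + t) ^ 2 := by positivity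
  have hφ1 : φ' ≤ 1 := by nlinarith
  have hφ3 : 1 / 3 ≤ φ' := by nlinarith
  have hv : (1 - φ' ^ 2) * (w * (1 + t)) ^ 2 = b * w ^ 2 := by
    rw [hsq]; field_simp; ring
  refine ⟨φ', hφ0, hφ1, ?_, ?_, ?_⟩
  · have h1 : b / (1 + t) ^ 2 ≤ 2 * (1 - φ') := by nlinarith
    have h2 : 16 / 3 * δ ≤ b := by nlinarith
    have h3 : 16 / 3 * δ * (100 / 121) ≤ b / (1 + t) ^ 2 := by
      rw [le_div_iff₀ hT]
      have : (1 + t) ^ 2 ≤ 121 / 100 := by nlinarith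
      nlinarith
    linarith
  · rw [hv]
  · set W := w * (1 + t) with hW
    have hWw : W - w = w * t := by rw [hW]; ring
    have hWw0 : 0 ≤ W - w := by rw [hWw]; positivity
    have key : (φ' * W - (1 - 4 * δ) * w) * (φ' * W + (1 - 4 * δ) * w) = (W - w) * (W + w) := by
      have : b = 1 - (1 - 4 * δ) ^ 2 := hb
      nlinarith
    have hden : (W + w) / 3 ≤ φ' * W + (1 - 4 * δ) * w := by nlinarith
    have hpos : 0 < W + w := by linarith
    have h0 : 0 ≤ φ' * W - (1 - 4 * δ) * w := by
      by_contra hneg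
      push Not at hneg
      have : 0 ≤ (W - w) * (W + w) := by positivity
      nlinarith
    rw [abs_le]
    have h1 : φ' * W - (1 - 4 * δ) * w ≤ 3 * (W - w) := by
      by_contra hneg
      push Not at hneg
      nlinarith
    have h2 : 3 * w * t = 3 * (W - w) := by rw [hWw]; ring
    constructor <;> linarith

lemma half_of_sum {a b S : ℝ} (h : 1 / 2 ≤ a + b) (ha : a ≤ S) (hb : b ≤ S) : 1 / 4 ≤ S := by
  linarith

lemma exp_half_le : Real.exp (1 / 2) ≤ 2 := by
  have h1 : Real.exp (1 / 2) * Real.exp (1 / 2) = Real.exp 1 := by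
    rw [← Real.exp_add]; norm_num
  have h2 := Real.exp_one_lt_d9
  have h3 := Real.exp_pos (1 / 2)
  nlinarith

lemma pair_bound {K : ℕ} (hK : 2 ≤ K) {ε w φ w' φ' v : ℝ} (h0 : 0 < ε) (hε : ε ≤ 1 / 16)
    (hv : (1 - φ ^ 2) * w ^ 2 / 4 = v) (hv' : (1 - φ' ^ 2) * w' ^ 2 / 4 = v)
    (hσ : |-(φ * w)| ≤ 1) (hσ' : |-(φ' * w')| ≤ 1) (hv0 : 0 ≤ v) (hv4 : v ≤ 1 / 4)
    (n : ℕ) (hn : n ≠ 0)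
    (hη : 2 * n * (4 * ε ^ 2 * v * |-(φ * w) - -(φ' * w')|) ^ 2 ≤ 1 / 2)
    (E E' : (Fin n → Fin K) → Prop) (hE : ∀ y, E y ∨ E' y) :
    1 / 2 ≤ probOf (model K ε w φ) n E + probOf (model K ε w' φ') n E' := by
  classical
  obtain ⟨m, rfl⟩ := Nat.exists_eq_succ_of_ne_zero hn
  simp only [Nat.succ_eq_add_one] at *
  unfold probOf
  simp only [pLaw_eq_fwd]
  have hc := chi_bound hK h0 hε hv hv' hσ hσ' hv0 hv4 m
  set η := 4 * ε ^ 2 * v * |-(φ * w) - -(φ' * w')|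
  have hc2 : (1 + 2 * η ^ 2) ^ m ≤ 2 := by
    calc (1 + 2 * η ^ 2) ^ m ≤ (Real.exp (2 * η ^ 2)) ^ m := by
          gcongr
          linarith [Real.add_one_le_exp (2 * η ^ 2)]
      _ = Real.exp (m * (2 * η ^ 2)) := by rw [← Real.exp_nat_mul]
      _ ≤ Real.exp (1 / 2) := by
          apply Real.exp_le_exp.2
          push_cast at hη
          nlinarith [sq_nonneg η]
      _ ≤ 2 := exp_half_le
  have := two_point (mP (K := K) ε w φ m) (mP ε w' φ' m)
    (fun y => (mono_inv hK h0 hε hv hσ hv0 hv4 m y).1)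
    (fun y => (mono_inv hK h0 hε hv' hσ' hv0 hv4 m y).1)
    (sum_mP hK (by linarith) m) (hc.trans hc2) E E' hE
  unfold mP at this
  convert this using 3

lemma pq_aux {δ ε x : ℝ} (hε : ε ≤ 1 / 16) (hx : 0 ≤ x) (h : δ ≤ 15 / 32 * x) :
    δ ≤ (1 - ε) * x / 2 := by
  nlinarith

set_option maxHeartbeats 1000000 in
theorem statement16 (K : ℕ) (hK : 2 ≤ K) :
    ∃ c ε₀ : ℝ, 0 < c ∧ 0 < ε₀ ∧
      ∀ (L δ ε ζ : ℝ) (n : ℕ),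
        0 < L → L ≤ 1 / 3 →
        δ ∈ Set.Ioo (0 : ℝ) 1 → δ ≤ 1 / 6 →
        ε ∈ Set.Ioo (0 : ℝ) 1 → ε ≤ ε₀ →
        0 < ζ → ζ ≤ Real.sqrt (2 * ((K / 2 : ℕ) : ℝ)) / (4 * K) →
        1 ≤ n * δ ^ 2 * ε ^ 4 * ζ ^ 6 →
        (∀ est : (Fin n → Fin K) → ℝ,
          1 / 4 ≤ ⨆ π ∈ PhiL K L δ ε ζ,
            probOf (unpack π) n (fun y =>
              c / (n * δ ^ 2 * ε ^ 4 * ζ ^ 4) ≤ |est y - π.1.2.2| ^ 2))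
        ∧ (∀ est : (Fin n → Fin K) → ℝ,
          1 / 4 ≤ ⨆ π ∈ PhiL K L δ ε ζ,
            probOf (unpack π) n (fun y =>
              c / (n * δ ^ 2 * ε ^ 4 * ζ ^ 6) ≤ |est y / π.1.2.2 - 1| ^ 2)) := by
  have hK0 : (0 : ℝ) < K := by positivity
  have hK1 : (2 : ℝ) ≤ K := by exact_mod_cast hK
  have hK3 : (1 : ℝ) ≤ (K : ℝ) ^ 3 := one_le_pow₀ (by linarith)
  obtain ⟨τ, hτ⟩ : ∃ τ : ℝ, τ = 1 / (48 * (K : ℝ) ^ 3) := ⟨_, rfl⟩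
  have hτ0 : 0 < τ := by rw [hτ]; positivity
  have hτ1 : τ ≤ 1 / 48 := by
    rw [hτ]
    apply one_div_le_one_div_of_le <;> nlinarith
  have hτK : 48 * (K : ℝ) ^ 3 * τ = 1 := by rw [hτ]; field_simp
  refine ⟨(τ / 3) ^ 2, 1 / 16, by positivity, by norm_num, ?_⟩
  intro L δ ε ζ n hL0 hL ⟨hδ0, _⟩ hδ6 ⟨hε0, _⟩ hε hζ hζN hn
  obtain ⟨N, hN⟩ : ∃ N : ℝ, N = Real.sqrt (2 * ((K / 2 : ℕ) : ℝ)) := ⟨_, rfl⟩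
  have hN1 : 1 ≤ N := by
    rw [hN, Real.one_le_sqrt]
    have : (1 : ℝ) ≤ ((K / 2 : ℕ) : ℝ) := by exact_mod_cast (by omega : 1 ≤ K / 2)
    linarith
  have hN0 : 0 < N := by linarith
  rw [← hN] at hζN
  have hn0 : n ≠ 0 := by
    rintro rfl
    norm_num at hn
  have hnR : (0 : ℝ) < n := by positivity
  obtain ⟨R, hR⟩ : ∃ R : ℝ, R = Real.sqrt n * δ * ε ^ 2 * ζ ^ 3 := ⟨_, rfl⟩
  have hsn : Real.sqrt n ^ 2 = n := Real.sq_sqrt hnR.le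
  have hR0 : 0 < R := by rw [hR]; positivity
  have hR2 : R ^ 2 = n * δ ^ 2 * ε ^ 4 * ζ ^ 6 := by
    have : R ^ 2 = Real.sqrt n ^ 2 * δ ^ 2 * ε ^ 4 * ζ ^ 6 := by rw [hR]; ring
    rw [this, hsn]
  have hR1 : 1 ≤ R := by
    rw [← hR2] at hn
    nlinarith only [hn, hR0]
  obtain ⟨t, ht⟩ : ∃ t : ℝ, t = τ / R := ⟨_, rfl⟩
  have ht0 : 0 < t := by rw [ht]; positivity
  have ht1 : t ≤ 1 / 10 := by
    rw [ht, div_le_iff₀ hR0]; linarith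
  have hc6 : (τ / 3) ^ 2 / (n * δ ^ 2 * ε ^ 4 * ζ ^ 6) = (t / 3) ^ 2 := by
    rw [← hR2, ht]; field_simp
  have hc4 : (τ / 3) ^ 2 / (n * δ ^ 2 * ε ^ 4 * ζ ^ 4) = (t * ζ / 3) ^ 2 := by
    have : (t * ζ / 3) ^ 2 = (t / 3) ^ 2 * ζ ^ 2 := by ring
    rw [this, ← hc6]
    field_simp
  rw [hc6, hc4]
  obtain ⟨w, hw⟩ : ∃ w : ℝ, w = ζ * K / N := ⟨_, rfl⟩
  have hw0 : 0 < w := by rw [hw]; positivity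
  have hw4 : w ≤ 1 / 4 := by
    rw [hw, div_le_iff₀ hN0]
    rw [le_div_iff₀ (by positivity)] at hζN
    linarith
  have hwK : w ≤ ζ * K := by
    rw [hw]; exact div_le_self (by positivity) hN1
  obtain ⟨φ', hφ0, hφ1, hφδ, hv', hσd⟩ := exists_phi hδ0 hδ6 hw0 ht0.le ht1
  have hw'0 : 0 < w * (1 + t) := by positivity
  have hw'1 : w * (1 + t) ≤ 1 := by nlinarith only [hw0, hw4, ht0, ht1]
  have e0 : w * N / K = ζ := by rw [hw]; field_simp
  have e1 : w * (1 + t) * N / K = ζ * (1 + t) := by rw [hw]; field_simp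
  have m0 : model K ε w (1 - 4 * δ) ∈ ThetaL K L δ ε ζ := by
    refine model_mem hK hL hδ0 hε0 hε hw0.le (by linarith) (by linarith) (by linarith) ?_ ?_ ?_
    · exact pq_aux hε (by linarith) (by linarith)
    · exact pq_aux hε (by linarith) (by linarith)
    · rw [← hN, e0]
  have m1 : model K ε (w * (1 + t)) φ' ∈ ThetaL K L δ ε ζ := by
    refine model_mem hK hL hδ0 hε0 hε hw'0.le hw'1 hφ0 hφ1 ?_ ?_ ?_
    · exact pq_aux hε (by linarith) (by linarith)
    · exact pq_aux hε (by linarith) (by linarith)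
    · rw [← hN, e1]; nlinarith only [hζ, ht0]
  have p0 : (pack (model K ε w (1 - 4 * δ))).1.2.2 = ζ := by
    change enormF _ = _
    rw [model_enorm hK _ _ _ hw0.le, ← hN, e0]
  have p1 : (pack (model K ε (w * (1 + t)) φ')).1.2.2 = ζ * (1 + t) := by
    change enormF _ = _
    rw [model_enorm hK _ _ _ hw'0.le, ← hN, e1]
  obtain ⟨v, hv⟩ : ∃ v : ℝ, (1 - (1 - 4 * δ) ^ 2) * w ^ 2 / 4 = v := ⟨_, rfl⟩
  rw [hv] at hv'
  have hveq : v = (2 * δ - 4 * δ ^ 2) * w ^ 2 := by rw [← hv]; ring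
  have hw2 : w ^ 2 ≤ 1 / 16 := by
    have : w ^ 2 ≤ (1 / 4) ^ 2 := by gcongr
    linarith
  have hv0 : 0 ≤ v := by
    rw [hveq]; exact mul_nonneg (by nlinarith only [hδ0, hδ6]) (by positivity)
  have hvδ : v ≤ 2 * δ * w ^ 2 := by
    rw [hveq]; gcongr; linarith [sq_nonneg δ]
  have hv4 : v ≤ 1 / 4 := by
    have : 2 * δ * w ^ 2 ≤ 2 * (1 / 6) * (1 / 16) := by gcongr
    linarith
  have hσ : |-((1 - 4 * δ) * w)| ≤ 1 := by
    rw [abs_neg, abs_of_nonneg (mul_nonneg (by linarith) hw0.le)]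
    exact mul_le_one₀ (by linarith) hw0.le (by linarith)
  have hσ' : |-(φ' * (w * (1 + t)))| ≤ 1 := by
    rw [abs_neg, abs_of_nonneg (by positivity)]
    exact mul_le_one₀ hφ1 hw'0.le hw'1
  have hη : 2 * n * (4 * ε ^ 2 * v * |-((1 - 4 * δ) * w) - -(φ' * (w * (1 + t)))|) ^ 2
      ≤ 1 / 2 := by
    rw [abs_sub_comm]
    have h1 : 4 * ε ^ 2 * v * |-(φ' * (w * (1 + t))) - -((1 - 4 * δ) * w)|
        ≤ 4 * ε ^ 2 * (2 * δ * (ζ * K) ^ 2) * (3 * (ζ * K) * t) := by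
      gcongr
      · exact hvδ.trans (by gcongr)
      · exact hσd.trans (by gcongr)
    have h2 : 4 * ε ^ 2 * (2 * δ * (ζ * K) ^ 2) * (3 * (ζ * K) * t) = 1 / (2 * Real.sqrt n) := by
      have hs0 : 0 < Real.sqrt n := by positivity
      have h3 : 4 * ε ^ 2 * (2 * δ * (ζ * K) ^ 2) * (3 * (ζ * K) * t)
          = (48 * (K : ℝ) ^ 3 * τ) * (ε ^ 2 * δ * ζ ^ 3 / (2 * R)) := by
        rw [ht]; field_simp; ring
      rw [h3, hτK, hR]
      field_simp
    rw [h2] at h1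
    calc _ ≤ 2 * n * (1 / (2 * Real.sqrt n)) ^ 2 := by gcongr
      _ = 1 / 2 := by
        rw [div_pow, mul_pow, hsn]; field_simp
  constructor
  · intro est
    have hp := pair_bound hK hε0 hε hv hv' hσ hσ' hv0 hv4 n hn0 hη
      (fun y => (t * ζ / 3) ^ 2 ≤ |est y - (pack (model K ε w (1 - 4 * δ))).1.2.2| ^ 2)
      (fun y => (t * ζ / 3) ^ 2 ≤ |est y - (pack (model K ε (w * (1 + t)) φ')).1.2.2| ^ 2) ?_
    · exact half_of_sum hp
        (sup_ge hζ n (fun π y => (t * ζ / 3) ^ 2 ≤ |est y - π.1.2.2| ^ 2) _ m0)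
        (sup_ge hζ n (fun π y => (t * ζ / 3) ^ 2 ≤ |est y - π.1.2.2| ^ 2) _ m1)
    · intro y
      rw [p0, p1]
      by_contra hcon
      push Not at hcon
      obtain ⟨h1, h2⟩ := hcon
      have htz : 0 < t * ζ := by positivity
      have h1 := abs_lt.1 (lt_of_pow_lt_pow_left₀ 2 (by positivity) h1)
      have h2 := abs_lt.1 (lt_of_pow_lt_pow_left₀ 2 (by positivity) h2)
      nlinarith only [h1.1, h1.2, h2.1, h2.2, htz]
  · intro est
    have hp := pair_bound hK hε0 hε hv hv' hσ hσ' hv0 hv4 n hn0 hη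
      (fun y => (t / 3) ^ 2 ≤ |est y / (pack (model K ε w (1 - 4 * δ))).1.2.2 - 1| ^ 2)
      (fun y => (t / 3) ^ 2 ≤ |est y / (pack (model K ε (w * (1 + t)) φ')).1.2.2 - 1| ^ 2) ?_
    · exact half_of_sum hp
        (sup_ge hζ n (fun π y => (t / 3) ^ 2 ≤ |est y / π.1.2.2 - 1| ^ 2) _ m0)
        (sup_ge hζ n (fun π y => (t / 3) ^ 2 ≤ |est y / π.1.2.2 - 1| ^ 2) _ m1)
    · intro y
      rw [p0, p1]
      by_contra hcon
      push Not at hcon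
      obtain ⟨h1, h2⟩ := hcon
      have h1 := abs_lt.1 (lt_of_pow_lt_pow_left₀ 2 (by positivity) h1)
      have h2 := abs_lt.1 (lt_of_pow_lt_pow_left₀ 2 (by positivity) h2)
      have e : est y / ζ = est y / (ζ * (1 + t)) * (1 + t) := by field_simp
      rw [e] at h1
      nlinarith only [h1.1, h1.2, h2.1, h2.2, ht0, ht1]

end PaperHMM
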